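/- arXiv:2512.24295 — 4 statements merged into one kernel-verified Lean document; each statement's English description precedes it below -/
import Mathlib

section
/- If x ∈ R_z ∩ R_{z'} for two distinct activation patterns z ≠ z', then some neuron is binding at x: there exist a hidden layer l and neuron i with g^l_i(x) = 0. Equivalently, an input lies in more than one linear region only if some neuron is binding there. -/
open Matrix

/-- A ReLU network with input dimension `n 0`, hidden layer widths `n 1, …, n L`
(layer `l+1` has weights `W l : Matrix (Fin (n (l+1))) (Fin (n l)) ℝ` and bias `b l`),
and an output layer with weight row vector `wOut` and bias `bOut`. -/
structure ReLUNet (n : ℕ → ℕ) (L : ℕ) where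
  W : ∀ l : ℕ, Matrix (Fin (n (l + 1))) (Fin (n l)) ℝ
  b : ∀ l : ℕ, Fin (n (l + 1)) → ℝ
  wOut : Fin (n L) → ℝ
  bOut : ℝ

namespace ReLUNet

variable {n : ℕ → ℕ} {L : ℕ}

/-- ReLU layer outputs `h^l` on input `x` (`h^0 = x`). -/
def hout (N : ReLUNet n L) (x : Fin (n 0) → ℝ) : (l : ℕ) → Fin (n l) → ℝ
  | 0 => x
  | l + 1 => fun i => max 0 (N.W l i ⬝ᵥ N.hout x l + N.b l i)

/-- Preactivation `g^{l+1}_i(x)` of hidden layer `l+1` (for `l < L`). -/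
def gact (N : ReLUNet n L) (x : Fin (n 0) → ℝ) (l : ℕ) (i : Fin (n (l + 1))) : ℝ :=
  N.W l i ⬝ᵥ N.hout x l + N.b l i

/-- Network output `f(x) = W^{L+1} h^L + b^{L+1}`. -/
def f (N : ReLUNet n L) (x : Fin (n 0) → ℝ) : ℝ :=
  N.wOut ⬝ᵥ N.hout x L + N.bOut

/-- An activation pattern: one Boolean `z^{l+1}_i` per hidden neuron. -/
def Pattern (n : ℕ → ℕ) (L : ℕ) : Type :=
  ∀ l : Fin L, Fin (n (l.val + 1)) → Bool

/-- Extension of a pattern to all natural layer indices (irrelevant above `L`). -/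
def patExt (z : Pattern n L) (l : ℕ) (i : Fin (n (l + 1))) : Bool :=
  if h : l < L then z ⟨l, h⟩ i else true

/-- Gated layer outputs `ĥ^l`: `ĥ^{l+1}_i = z^{l+1}_i · ĝ^{l+1}_i`. -/
def hgate (N : ReLUNet n L) (z : Pattern n L) (x : Fin (n 0) → ℝ) :
    (l : ℕ) → Fin (n l) → ℝ
  | 0 => x
  | l + 1 => fun i =>
      if patExt z l i then N.W l i ⬝ᵥ N.hgate z x l + N.b l i else 0

/-- Gated preactivation `ĝ^{l+1}_i(x)`. -/
def ggate (N : ReLUNet n L) (z : Pattern n L) (x : Fin (n 0) → ℝ) (l : ℕ)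
    (i : Fin (n (l + 1))) : ℝ :=
  N.W l i ⬝ᵥ N.hgate z x l + N.b l i

/-- Gated network output `f_z(x)`. -/
def fgate (N : ReLUNet n L) (z : Pattern n L) (x : Fin (n 0) → ℝ) : ℝ :=
  N.wOut ⬝ᵥ N.hgate z x L + N.bOut

/-- The linear region `R_z`. -/
def Region (N : ReLUNet n L) (z : Pattern n L) : Set (Fin (n 0) → ℝ) :=
  {x | ∀ (l : Fin L) (i : Fin (n (l.val + 1))),
    (z l i = true → 0 ≤ N.ggate z x l.val i) ∧
    (z l i = false → N.ggate z x l.val i ≤ 0)}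

/-- `x` is non-binding: no hidden preactivation vanishes at `x`. -/
def NonBinding (N : ReLUNet n L) (x : Fin (n 0) → ℝ) : Prop :=
  ∀ (l : Fin L) (i : Fin (n (l.val + 1))), N.gact x l.val i ≠ 0

/-- The activation pattern of `x`: `z^l_i = 1` iff `g^l_i(x) ≥ 0`. -/
noncomputable def patternOf (N : ReLUNet n L) (x : Fin (n 0) → ℝ) : Pattern n L :=
  fun l i => decide (0 ≤ N.gact x l.val i)

/-- The activation pattern of `x` with strict signs: `z(x)^l_i = 1` iff `g^l_i(x) > 0`. -/
noncomputable def posPattern (N : ReLUNet n L) (x : Fin (n 0) → ℝ) : Pattern n L :=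
  fun l i => decide (0 < N.gact x l.val i)

/-- The matrix product `D(z^l) W^l ⋯ D(z^1) W^1`. -/
def gateMat (N : ReLUNet n L) (z : Pattern n L) :
    (l : ℕ) → Matrix (Fin (n l)) (Fin (n 0)) ℝ
  | 0 => 1
  | l + 1 =>
      Matrix.diagonal (fun i => if patExt z l i then (1 : ℝ) else 0) *
        (N.W l * N.gateMat z l)

/-- The row vector `T(z) = W^{L+1} D(z^L) W^L ⋯ D(z^1) W^1`. -/
def Tz (N : ReLUNet n L) (z : Pattern n L) : Fin (n 0) → ℝ :=
  Matrix.vecMul N.wOut (N.gateMat z L)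

end ReLUNet

/-- The Euclidean norm on `ℝ^m` (as plain functions). -/
noncomputable def euclNorm {m : ℕ} (v : Fin m → ℝ) : ℝ :=
  Real.sqrt (∑ j, v j ^ 2)


theorem ReLUNet.hgate_eq_hout {n : ℕ → ℕ} {L : ℕ} (N : ReLUNet n L)
    (z : ReLUNet.Pattern n L) (x : Fin (n 0) → ℝ) (hx : x ∈ N.Region z) :
    ∀ l : ℕ, l ≤ L → N.hgate z x l = N.hout x l := by
  intro l
  induction l with
  | zero => intro _; rfl
  | succ l ih =>
    intro hl
    have hlt : l < L := hl
    have e := ih hlt.le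
    funext i
    have h := hx ⟨l, hlt⟩ i
    simp only [ReLUNet.ggate, e] at h
    simp only [ReLUNet.hgate, ReLUNet.hout, ReLUNet.patExt, hlt, dif_pos, e]
    cases hz : z ⟨l, hlt⟩ i
    · simpa using h.2 hz
    · simpa using h.1 hz

/-- If `x` lies in the linear regions of two distinct activation
patterns, then some neuron is binding at `x`: there are a hidden layer `l` and neuron `i`
with `g^l_i(x) = 0`. -/
theorem binding_of_two_regions {n : ℕ → ℕ} {L : ℕ} (hL : 1 ≤ L)
    (N : ReLUNet n L) (z z' : ReLUNet.Pattern n L) (hzz : z ≠ z')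
    (x : Fin (n 0) → ℝ) (hx : x ∈ N.Region z ∩ N.Region z') :
    ∃ (l : Fin L) (i : Fin (n (l.val + 1))), N.gact x l.val i = 0 := by
  by_contra hc
  push Not at hc
  apply hzz
  funext l i
  have h1 := hx.1 l i
  have h2 := hx.2 l i
  have hne := hc l i
  simp only [ReLUNet.ggate, N.hgate_eq_hout z x hx.1 l.val l.isLt.le] at h1
  simp only [ReLUNet.ggate, N.hgate_eq_hout z' x hx.2 l.val l.isLt.le] at h2
  simp only [ReLUNet.gact] at hne
  cases hz : z l i <;> cases hz' : z' l i
  · rfl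
  · exact absurd (le_antisymm (h1.2 hz) (h2.1 hz')) hne
  · exact absurd (le_antisymm (h2.2 hz') (h1.1 hz)) hne
  · rfl
end

section
/- Let x ∈ ℝ^{n₀} and suppose there are vectors g^l, h^l ∈ ℝ^{n_l} (l = 1, …, L, with h⁰ = x) and binary values z^l_i ∈ {0,1} satisfying the MILP constraints: g^l = W^l h^{l−1} + b^l for all l; for every hidden layer l and neuron i, if z^l_i = 1 then h^l_i = g^l_i, and if z^l_i = 0 then g^l_i ≤ 0 and h^l_i = 0; and h^l_i ≥ 0 for all l, i. Then h^l_i = max(0, g^l_i) for every l and i, so that the values g^l and h^l are exactly the preactivations and outputs of the ReLU network on input x, and the model objective W^{L+1} h^L + b^{L+1} equals f(x). -/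
open Matrix

/-- Any point satisfying the MILP constraints recovers exactly the ReLU
computation: `h^l_i = max(0, g^l_i)`, the `g`'s and `h`'s are the preactivations and
outputs of the network on input `x`, and the objective equals `f(x)`. -/
theorem milp_constraints_force_relu {n : ℕ → ℕ} {L : ℕ} (hL : 1 ≤ L)
    (N : ReLUNet n L) (x : Fin (n 0) → ℝ)
    (G : ∀ l : Fin L, Fin (n (l.val + 1)) → ℝ)
    (H : ∀ l : ℕ, Fin (n l) → ℝ)
    (z : ReLUNet.Pattern n L)
    (h0 : H 0 = x)
    (hlin : ∀ (l : Fin L) (i : Fin (n (l.val + 1))),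
        G l i = N.W l.val i ⬝ᵥ H l.val + N.b l.val i)
    (hind1 : ∀ (l : Fin L) (i : Fin (n (l.val + 1))),
        z l i = true → H (l.val + 1) i = G l i)
    (hind0 : ∀ (l : Fin L) (i : Fin (n (l.val + 1))),
        z l i = false → G l i ≤ 0 ∧ H (l.val + 1) i = 0)
    (hpos : ∀ (l : Fin L) (i : Fin (n (l.val + 1))), 0 ≤ H (l.val + 1) i) :
    (∀ (l : Fin L) (i : Fin (n (l.val + 1))),
        H (l.val + 1) i = max 0 (G l i) ∧
        G l i = N.gact x l.val i ∧
        H (l.val + 1) i = N.hout x (l.val + 1) i) ∧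
    N.wOut ⬝ᵥ H L + N.bOut = N.f x := by
  have hmax : ∀ (l : Fin L) (i : Fin (n (l.val + 1))),
      H (l.val + 1) i = max 0 (G l i) := by
    intro l i
    cases hz : z l i with
    | true =>
      have h1 := hind1 l i hz
      rw [max_eq_right (h1 ▸ hpos l i), h1]
    | false =>
      obtain ⟨h1, h2⟩ := hind0 l i hz
      rw [max_eq_left h1, h2]
  have hH : ∀ l : ℕ, l ≤ L → H l = N.hout x l := by
    intro l
    induction l with
    | zero => intro _; rw [h0, ReLUNet.hout]
    | succ k ih =>
      intro hk
      funext i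
      have h1 := hmax ⟨k, hk⟩ i
      have h2 := hlin ⟨k, hk⟩ i
      simp only at h1 h2
      rw [h1, h2, ih (by omega), ReLUNet.hout]
  refine ⟨fun l i => ⟨hmax l i, ?_, ?_⟩, ?_⟩
  · rw [hlin l i, hH l.val l.isLt.le, ReLUNet.gact]
  · rw [hH (l.val + 1) l.isLt]
  · rw [hH L le_rfl, ReLUNet.f]
end

section
/- For every x ∈ ℝ^{n₀}, setting g^l and h^l to the ReLU network's preactivations and outputs on input x, and setting z^l_i = 1 if g^l_i ≥ 0 and z^l_i = 0 otherwise, yields a feasible point of the MILP constraints with objective value f(x). Consequently, for any set X ⊆ ℝ^{n₀}, the set of objective values attained by feasible points of the MILP with x ∈ X equals {f(x) : x ∈ X}; in particular, if f attains a maximum over X, the optimal value of the MILP equals max_{x ∈ X} f(x). -/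
open Matrix

/-- Feasibility of `(x, G, H, z)` for the MILP constraints (with `x ∈ X`). -/
def MILPFeasible {n : ℕ → ℕ} {L : ℕ} (N : ReLUNet n L) (X : Set (Fin (n 0) → ℝ))
    (x : Fin (n 0) → ℝ) (G : ∀ l : Fin L, Fin (n (l.val + 1)) → ℝ)
    (H : ∀ l : ℕ, Fin (n l) → ℝ) (z : ReLUNet.Pattern n L) : Prop :=
  H 0 = x ∧ x ∈ X ∧
  (∀ (l : Fin L) (i : Fin (n (l.val + 1))),
      G l i = N.W l.val i ⬝ᵥ H l.val + N.b l.val i) ∧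
  (∀ (l : Fin L) (i : Fin (n (l.val + 1))), z l i = true → H (l.val + 1) i = G l i) ∧
  (∀ (l : Fin L) (i : Fin (n (l.val + 1))),
      z l i = false → G l i ≤ 0 ∧ H (l.val + 1) i = 0) ∧
  (∀ (l : Fin L) (i : Fin (n (l.val + 1))), 0 ≤ H (l.val + 1) i)

/-- Objective value of the MILP at a feasible point. -/
def MILPObj {n : ℕ → ℕ} {L : ℕ} (N : ReLUNet n L) (H : ∀ l : ℕ, Fin (n l) → ℝ) : ℝ :=
  N.wOut ⬝ᵥ H L + N.bOut

/-- For every `x`, the network's own preactivations/outputs together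
with the pattern `z^l_i = 1` iff `g^l_i ≥ 0` give a feasible MILP point with objective
`f(x)`; consequently the set of MILP objective values equals `{f(x) : x ∈ X}`, and if `f`
attains its maximum over `X` at `xstar`, then `f(xstar)` is the optimal MILP value. -/
theorem milp_equals_network_optimization {n : ℕ → ℕ} {L : ℕ} (hL : 1 ≤ L)
    (N : ReLUNet n L) (X : Set (Fin (n 0) → ℝ)) :
    (∀ x ∈ X,
        MILPFeasible N X x (fun l i => N.gact x l.val i) (fun l => N.hout x l)
          (N.patternOf x) ∧
        MILPObj N (fun l => N.hout x l) = N.f x) ∧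
    {v : ℝ | ∃ x G H z, MILPFeasible N X x G H z ∧ MILPObj N H = v} = N.f '' X ∧
    (∀ xstar ∈ X, (∀ x ∈ X, N.f x ≤ N.f xstar) →
        IsGreatest {v : ℝ | ∃ x G H z, MILPFeasible N X x G H z ∧ MILPObj N H = v}
          (N.f xstar)) := by
  have h1 : ∀ x ∈ X,
        MILPFeasible N X x (fun l i => N.gact x l.val i) (fun l => N.hout x l)
          (N.patternOf x) ∧
        MILPObj N (fun l => N.hout x l) = N.f x := by
    intro x hx
    refine ⟨⟨rfl, hx, fun l i => rfl, ?_, ?_, ?_⟩, rfl⟩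
    · intro l i hz
      have hz' : 0 ≤ N.gact x l.val i := of_decide_eq_true hz
      exact max_eq_right hz'
    · intro l i hz
      have hz' : ¬ 0 ≤ N.gact x l.val i := of_decide_eq_false hz
      have hz2 : N.gact x l.val i ≤ 0 := le_of_lt (not_le.mp hz')
      exact ⟨hz2, max_eq_left hz2⟩
    · intro l i
      exact le_max_left _ _
  have h2 : {v : ℝ | ∃ x G H z, MILPFeasible N X x G H z ∧ MILPObj N H = v} = N.f '' X := by
    ext v
    constructor
    · rintro ⟨x, G, H, z, ⟨h0, hx, hG, ht, hf, hn⟩, hv⟩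
      have key : ∀ l : ℕ, l ≤ L → H l = N.hout x l := by
        intro l
        induction l with
        | zero => intro _; exact h0
        | succ l ih =>
          intro hl
          have hH := ih (by omega)
          funext i
          have g1 := hG ⟨l, hl⟩ i
          have t1 := ht ⟨l, hl⟩ i
          have f1 := hf ⟨l, hl⟩ i
          have n1 := hn ⟨l, hl⟩ i
          simp only at g1 t1 f1 n1
          rw [hH] at g1
          change H (l + 1) i = max 0 (N.W l i ⬝ᵥ N.hout x l + N.b l i)
          rw [← g1]
          cases hz : z ⟨l, hl⟩ i with
          | true =>
            have e := t1 hz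
            rw [e] at n1
            rw [e, max_eq_right n1]
          | false =>
            obtain ⟨a, e⟩ := f1 hz
            rw [e, max_eq_left a]
      refine ⟨x, hx, ?_⟩
      rw [← hv]
      unfold MILPObj ReLUNet.f
      rw [key L le_rfl]
    · rintro ⟨x, hx, rfl⟩
      exact ⟨x, _, _, _, h1 x hx⟩
  refine ⟨h1, h2, ?_⟩
  intro xs hxs hmax
  rw [h2]
  refine ⟨⟨xs, hxs, rfl⟩, ?_⟩
  rintro _ ⟨x, hx, rfl⟩
  exact hmax x hx
end

section
/- (Validity of the ratio test.) Let z be an activation pattern, x ∈ R_z, and d ∈ ℝ^{n₀} a direction. For each hidden layer l and neuron i, let Δ^l_i = ĝ^l_i(x + d) − ĝ^l_i(x), and define u = min{ −ĝ^l_i(x)/Δ^l_i : Δ^l_i ≠ 0 and −ĝ^l_i(x)/Δ^l_i ≥ 0 }, with u = +∞ if this set is empty. Then, since each ĝ^l_i is affine, ĝ^l_i(x + t·d) = ĝ^l_i(x) + t·Δ^l_i for all t ∈ ℝ, and for every t with 0 ≤ t ≤ u the point x + t·d remains in the linear region R_z; consequently f(x + t·d) = f_z(x + t·d) for all such t. 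-/
open Matrix

theorem aux_hgate {n : ℕ → ℕ} {L : ℕ} (N : ReLUNet n L) (z : ReLUNet.Pattern n L)
    (x d : Fin (n 0) → ℝ) (t : ℝ) (l : ℕ) :
    N.hgate z (x + t • d) l = N.hgate z x l + t • (N.hgate z (x + d) l - N.hgate z x l) := by
  induction l with
  | zero => simp [ReLUNet.hgate]
  | succ l ih =>
    funext i
    simp only [ReLUNet.hgate, Pi.add_apply, Pi.smul_apply, Pi.sub_apply, smul_eq_mul]
    split_ifs
    · rw [ih]
      simp only [dotProduct_add, dotProduct_smul, dotProduct_sub, smul_eq_mul]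
      ring
    · simp

theorem aux_ggate {n : ℕ → ℕ} {L : ℕ} (N : ReLUNet n L) (z : ReLUNet.Pattern n L)
    (x d : Fin (n 0) → ℝ) (t : ℝ) (l : ℕ) (i : Fin (n (l + 1))) :
    N.ggate z (x + t • d) l i =
      N.ggate z x l i + t * (N.ggate z (x + d) l i - N.ggate z x l i) := by
  simp only [ReLUNet.ggate]
  rw [aux_hgate]
  simp only [dotProduct_add, dotProduct_smul, dotProduct_sub, smul_eq_mul]
  ring

theorem aux_hout {n : ℕ → ℕ} {L : ℕ} (N : ReLUNet n L) (z : ReLUNet.Pattern n L)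
    (y : Fin (n 0) → ℝ) (hy : y ∈ N.Region z) (l : ℕ) (hl : l ≤ L) :
    N.hout y l = N.hgate z y l := by
  induction l with
  | zero => rfl
  | succ l ih =>
    funext i
    have h := hy ⟨l, hl⟩ i
    simp only [ReLUNet.ggate] at h
    simp only [ReLUNet.hout, ReLUNet.hgate]
    rw [ih (by omega)]
    have hp : ReLUNet.patExt z l i = z ⟨l, hl⟩ i := by
      unfold ReLUNet.patExt
      exact dif_pos hl
    rw [hp]
    cases hz : z ⟨l, hl⟩ i with
    | true => simpa using h.1 hz
    | false => simpa using h.2 hz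

/-- **validity of the ratio test.** Let `x ∈ R_z` and `d` a direction; set
`Δ^l_i = ĝ^l_i(x + d) − ĝ^l_i(x)`. Each `ĝ^l_i` is affine along the ray:
`ĝ^l_i(x + t d) = ĝ^l_i(x) + t Δ^l_i`; and every `t ≥ 0` that is at most every
nonnegative ratio `−ĝ^l_i(x)/Δ^l_i` (over `Δ^l_i ≠ 0`; no constraint if that set is
empty, i.e. `u = +∞`) keeps `x + t d` in `R_z`, whence `f(x + t d) = f_z(x + t d)`. -/
theorem ratio_test_valid {n : ℕ → ℕ} {L : ℕ} (hL : 1 ≤ L)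
    (N : ReLUNet n L) (z : ReLUNet.Pattern n L) (x d : Fin (n 0) → ℝ)
    (hx : x ∈ N.Region z) :
    (∀ (l : Fin L) (i : Fin (n (l.val + 1))) (t : ℝ),
        N.ggate z (x + t • d) l.val i =
          N.ggate z x l.val i +
            t * (N.ggate z (x + d) l.val i - N.ggate z x l.val i)) ∧
    (∀ t : ℝ, 0 ≤ t →
        (∀ (l : Fin L) (i : Fin (n (l.val + 1))),
            N.ggate z (x + d) l.val i - N.ggate z x l.val i ≠ 0 →
            0 ≤ -(N.ggate z x l.val i) /
                  (N.ggate z (x + d) l.val i - N.ggate z x l.val i) →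
            t ≤ -(N.ggate z x l.val i) /
                  (N.ggate z (x + d) l.val i - N.ggate z x l.val i)) →
        x + t • d ∈ N.Region z ∧ N.f (x + t • d) = N.fgate z (x + t • d)) := by
  refine ⟨fun l i t => aux_ggate N z x d t l.val i, fun t ht hr => ?_⟩
  have hm : x + t • d ∈ N.Region z := by
    intro l i
    have h := hx l i
    have hr' := hr l i
    rw [aux_ggate]
    generalize N.ggate z (x + d) l.val i - N.ggate z x l.val i = D at *
    generalize N.ggate z x l.val i = g at *
    constructor
    · intro hz
      have hg := h.1 hz
      rcases le_or_gt 0 D with hD | hD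
      · positivity
      · have h1 := hr' hD.ne (div_nonneg_of_nonpos (by linarith) hD.le)
        rw [le_div_iff_of_neg hD] at h1
        linarith
    · intro hz
      have hg := h.2 hz
      rcases le_or_gt D 0 with hD | hD
      · nlinarith [mul_nonneg ht (neg_nonneg.2 hD)]
      · have h1 := hr' hD.ne' (div_nonneg (by linarith) hD.le)
        rw [le_div_iff₀ hD] at h1
        linarith
  refine ⟨hm, ?_⟩
  unfold ReLUNet.f ReLUNet.fgate
  rw [aux_hout N z _ hm L le_rfl]
end
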